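/- arXiv:2407.10394 — 3 statements merged into one kernel-verified Lean document; each statement's English description precedes it below -/
import Mathlib

section
/- Let R be a λ-ring and for k ≥ 1 let ψ^k denote the Adams operation defined by ψ^1(x) = x and the Newton recursion ψ^k(x) = λ^1(x)·ψ^{k−1}(x) − λ^2(x)·ψ^{k−2}(x) + ⋯ + (−1)^k·λ^{k−1}(x)·ψ^1(x) + (−1)^{k+1}·k·λ^k(x). Then each ψ^k is a ring endomorphism of R: ψ^k(1) = 1, ψ^k(x+y) = ψ^k(x) + ψ^k(y), and ψ^k(x·y) = ψ^k(x)·ψ^k(y) for all x, y ∈ R. -/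
open Finset MvPolynomial

/-- The `n`-th elementary symmetric function of the family `f` restricted to the finite set `s`. -/
noncomputable def esymmAt {ι A : Type*} [CommRing A] (s : Finset ι) (n : ℕ) (f : ι → A) : A :=
  ∑ t ∈ s.powersetCard n, ∏ i ∈ t, f i

/-- `IsPk k P` says that `P` is the universal integer polynomial in `2k` variables with
`P(e_1(x),…,e_k(x); e_1(y),…,e_k(y))` equal to the `k`-th elementary symmetric polynomial of
the `k²` products `x_i·y_j`. -/
def IsPk (k : ℕ) (P : MvPolynomial (Fin k ⊕ Fin k) ℤ) : Prop :=
  aeval (Sum.elim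
      (fun i : Fin k => esymmAt Finset.univ (i.1 + 1)
        (fun j : Fin k => (X (Sum.inl j) : MvPolynomial (Fin k ⊕ Fin k) ℤ)))
      (fun i : Fin k => esymmAt Finset.univ (i.1 + 1)
        (fun j : Fin k => (X (Sum.inr j) : MvPolynomial (Fin k ⊕ Fin k) ℤ)))) P
    = esymmAt Finset.univ k
      (fun p : Fin k × Fin k =>
        (X (Sum.inl p.1) : MvPolynomial (Fin k ⊕ Fin k) ℤ) * X (Sum.inr p.2))

/-- `IsPkl k m Q` says that `Q` is the universal integer polynomial in `k·m` variables with
`Q(e_1(x),…,e_{km}(x))` equal to the `k`-th elementary symmetric polynomial of the products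
`x_{i_1}⋯x_{i_m}` over all `m`-element subsets of `{1,…,km}`. -/
def IsPkl (k m : ℕ) (Q : MvPolynomial (Fin (k * m)) ℤ) : Prop :=
  aeval (fun i : Fin (k * m) => esymmAt Finset.univ (i.1 + 1)
      (fun j : Fin (k * m) => (X j : MvPolynomial (Fin (k * m)) ℤ))) Q
    = esymmAt (Finset.univ.powersetCard m) k
      (fun t : Finset (Fin (k * m)) => ∏ i ∈ t, (X i : MvPolynomial (Fin (k * m)) ℤ))

/-- A λ-ring structure (in the sense of Grothendieck, i.e. a "special" λ-ring) on the
commutative ring `R`, given by operations `l n : R → R`. -/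
structure IsLambdaRing {R : Type*} [CommRing R] (l : ℕ → R → R) : Prop where
  map_zero : ∀ r, l 0 r = 1
  map_one : ∀ r, l 1 r = r
  add_eq : ∀ (n : ℕ) (r s : R), l n (r + s) = ∑ i ∈ Finset.range (n + 1), l i r * l (n - i) s
  one_eq : ∀ n, 1 < n → l n (1 : R) = 0
  mul_eq : ∀ k, 1 ≤ k → ∀ P : MvPolynomial (Fin k ⊕ Fin k) ℤ, IsPk k P →
    ∀ r s : R, l k (r * s) =
      aeval (Sum.elim (fun i : Fin k => l (i.1 + 1) r) (fun j : Fin k => l (j.1 + 1) s)) P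
  comp_eq : ∀ k m, 1 ≤ k → 1 ≤ m → ∀ Q : MvPolynomial (Fin (k * m)) ℤ, IsPkl k m Q →
    ∀ r : R, l k (l m r) = aeval (fun i : Fin (k * m) => l (i.1 + 1) r) Q

section Newton

/-- Newton's recursion, expressing the sequence `p` of power sums in terms of the sequence `e` of
elementary symmetric functions. -/
def IsNewtonPair {A : Type*} [CommRing A] (e p : ℕ → A) : Prop :=
  ∀ k, 1 ≤ k → p k = (∑ i ∈ Finset.Ico 1 k, (-1 : A) ^ (i + 1) * (e i * p (k - i))) +
    (-1 : A) ^ (k + 1) * (k : A) * e k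

variable {A B : Type*} [CommRing A] [CommRing B]

theorem IsNewtonPair.map {e p : ℕ → A} (h : IsNewtonPair e p) (f : A →+* B) :
    IsNewtonPair (fun n => f (e n)) (fun n => f (p n)) := fun k hk => by
  simp [h k hk, map_sum]

theorem IsNewtonPair.powerSum_unique {e p e' p' : ℕ → A} (h : IsNewtonPair e p)
    (h' : IsNewtonPair e' p') {n : ℕ} (he : ∀ k, 1 ≤ k → k ≤ n → e k = e' k) :
    ∀ k, 1 ≤ k → k ≤ n → p k = p' k := by
  intro k
  induction k using Nat.strong_induction_on with
  | _ k ih =>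
    intro hk hkn
    rw [h k hk, h' k hk, he k hk hkn]
    congr 1
    refine Finset.sum_congr rfl fun i hi => ?_
    rw [Finset.mem_Ico] at hi
    rw [he i hi.1 (by omega), ih (k - i) (by omega) (by omega) (by omega)]

theorem IsNewtonPair.elementary_unique [Algebra ℚ A] {e p e' p' : ℕ → A} (h : IsNewtonPair e p)
    (h' : IsNewtonPair e' p') {n : ℕ} (hp : ∀ k, 1 ≤ k → k ≤ n → p k = p' k) :
    ∀ k, 1 ≤ k → k ≤ n → e k = e' k := by
  intro k
  induction k using Nat.strong_induction_on with
  | _ k ih =>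
    intro hk hkn
    have hsum : ∑ i ∈ Finset.Ico 1 k, (-1 : A) ^ (i + 1) * (e i * p (k - i)) =
        ∑ i ∈ Finset.Ico 1 k, (-1 : A) ^ (i + 1) * (e' i * p' (k - i)) := by
      refine Finset.sum_congr rfl fun i hi => ?_
      rw [Finset.mem_Ico] at hi
      rw [ih i (by omega) hi.1 (by omega), hp (k - i) (by omega) (by omega)]
    have hk' := hp k hk hkn
    rw [h k hk, h' k hk, hsum, add_right_inj] at hk'
    have hu : IsUnit ((-1 : A) ^ (k + 1) * (k : A)) := by
      refine (isUnit_one.neg.pow _).mul ?_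
      have : (k : A) = algebraMap ℚ A k := by simp
      rw [this]
      exact (IsUnit.mk0 (k : ℚ) (by exact_mod_cast (by omega : k ≠ 0))).map _
    exact hu.mul_left_cancel hk'

theorem exists_powerSum (e : ℕ → A) : ∃ p, IsNewtonPair e p := by
  let F : (k : ℕ) → ((m : ℕ) → m < k → A) → A := fun k rec =>
    (∑ i ∈ (Finset.Ico 1 k).attach, (-1 : A) ^ (i.1 + 1) * (e i.1 * rec (k - i.1)
      (by have := Finset.mem_Ico.mp i.2; omega))) + (-1 : A) ^ (k + 1) * (k : A) * e k
  refine ⟨fun k => WellFounded.fix Nat.lt_wfRel.wf F k, fun k _ => ?_⟩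
  dsimp only
  rw [WellFounded.fix_eq]
  simp only [F]
  rw [Finset.sum_attach (Finset.Ico 1 k) fun i =>
    (-1 : A) ^ (i + 1) * (e i * WellFounded.fix Nat.lt_wfRel.wf F (k - i))]

theorem exists_elementary [Algebra ℚ A] (p : ℕ → A) : ∃ e, IsNewtonPair e p := by
  let F : (k : ℕ) → ((m : ℕ) → m < k → A) → A := fun k rec =>
    algebraMap ℚ A ((-1) ^ (k + 1) * (k : ℚ)⁻¹) *
    (p k - ∑ i ∈ (Finset.Ico 1 k).attach, (-1 : A) ^ (i.1 + 1) * (rec i.1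
      (by have := Finset.mem_Ico.mp i.2; omega) * p (k - i.1)))
  refine ⟨fun k => WellFounded.fix Nat.lt_wfRel.wf F k, fun k hk => ?_⟩
  dsimp only
  rw [WellFounded.fix_eq _ F k]
  simp only [F]
  rw [Finset.sum_attach (Finset.Ico 1 k) fun i =>
    (-1 : A) ^ (i + 1) * (WellFounded.fix Nat.lt_wfRel.wf F i * p (k - i)), ← mul_assoc]
  have : (-1 : A) ^ (k + 1) * (k : A) * algebraMap ℚ A ((-1) ^ (k + 1) * (k : ℚ)⁻¹) = 1 := by
    have h1 : (-1 : A) ^ (k + 1) * (k : A) = algebraMap ℚ A ((-1) ^ (k + 1) * k) := by simp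
    have hk0 : (k : ℚ) ≠ 0 := by exact_mod_cast (by omega : k ≠ 0)
    rw [h1, ← map_mul, mul_mul_mul_comm, ← mul_pow, mul_inv_cancel₀ hk0]
    simp
  rw [this, one_mul, add_sub_cancel]

/-- The Newton recursion as an identity between generating functions. -/
theorem isNewtonPair_iff_derivative {e p : ℕ → A} (he : e 0 = 1) :
    IsNewtonPair e p ↔ PowerSeries.derivative A (PowerSeries.mk e) =
      PowerSeries.mk e * PowerSeries.mk fun n => (-1) ^ n * p (n + 1) := by
  have key (n : ℕ) :
      (p (n + 1) = (∑ i ∈ Finset.Ico 1 (n + 1), (-1 : A) ^ (i + 1) * (e i * p (n + 1 - i))) +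
        (-1 : A) ^ (n + 1 + 1) * ((n + 1 : ℕ) : A) * e (n + 1)) ↔
      e (n + 1) * (n + 1) = ∑ i ∈ Finset.range (n + 1), e i * ((-1) ^ (n - i) * p (n - i + 1)) := by
    have hs : ∑ i ∈ Finset.range (n + 1), e i * ((-1) ^ (n - i) * p (n - i + 1)) =
        (-1) ^ n * (p (n + 1) -
          ∑ i ∈ Finset.Ico 1 (n + 1), (-1 : A) ^ (i + 1) * (e i * p (n + 1 - i))) := by
      rw [Finset.range_eq_Ico, Finset.sum_eq_sum_Ico_succ_bot (by omega), mul_sub, Finset.mul_sum,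
        sub_eq_add_neg, ← Finset.sum_neg_distrib]
      congr 1
      · simp [he]
      · refine Finset.sum_congr rfl fun i hi => ?_
        rw [Finset.mem_Ico] at hi
        obtain ⟨j, rfl⟩ := Nat.exists_eq_add_of_le (Nat.lt_succ_iff.mp hi.2)
        have h1 : i + j - i = j := by omega
        have h2 : i + j + 1 - i = j + 1 := by omega
        have h3 : ((-1 : A) ^ i) * (-1) ^ i = 1 := by rw [← mul_pow]; simp
        rw [h1, h2, pow_add, pow_succ]
        linear_combination (-e i * (-1) ^ j * p (j + 1)) * h3
    have hu : ((-1 : A) ^ n) * (-1) ^ n = 1 := by rw [← mul_pow]; simp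
    rw [hs]
    push_cast
    constructor <;> intro h
    · linear_combination (-(-1) ^ n) * h - (e (n + 1) * (n + 1)) * hu
    · linear_combination (-(-1) ^ n) * h - (p (n + 1) -
        ∑ i ∈ Finset.Ico 1 (n + 1), (-1 : A) ^ (i + 1) * (e i * p (n + 1 - i))) * hu
  rw [PowerSeries.ext_iff]
  simp only [PowerSeries.coeff_derivative, PowerSeries.coeff_mk, PowerSeries.coeff_mul,
    Finset.Nat.sum_antidiagonal_eq_sum_range_succ_mk]
  constructor
  · exact fun h n => (key n).mp (h (n + 1) (by omega))
  · intro h k hk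
    obtain ⟨n, rfl⟩ := Nat.exists_eq_add_of_le' hk
    exact (key n).mpr (h n)

theorem IsNewtonPair.add {e p e' p' : ℕ → A} (h : IsNewtonPair e p) (h' : IsNewtonPair e' p')
    (he : e 0 = 1) (he' : e' 0 = 1) :
    IsNewtonPair (fun n => ∑ i ∈ Finset.range (n + 1), e i * e' (n - i))
      (fun n => p n + p' n) := by
  rw [isNewtonPair_iff_derivative he] at h
  rw [isNewtonPair_iff_derivative he'] at h'
  rw [isNewtonPair_iff_derivative (by simp [he, he'])]
  have h1 : (PowerSeries.mk fun n => ∑ i ∈ Finset.range (n + 1), e i * e' (n - i)) =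
      PowerSeries.mk e * PowerSeries.mk e' := by
    ext n
    simp [PowerSeries.coeff_mul, Finset.Nat.sum_antidiagonal_eq_sum_range_succ_mk]
  have h2 : (PowerSeries.mk fun n => (-1) ^ n * (p (n + 1) + p' (n + 1))) =
      (PowerSeries.mk fun n => (-1) ^ n * p (n + 1)) +
        PowerSeries.mk fun n => (-1) ^ n * p' (n + 1) := by
    ext n
    simp [mul_add]
  rw [h1, h2, Derivation.leibniz, h, h', smul_eq_mul, smul_eq_mul]
  ring

end Newton

section Elementary

variable {A B ι : Type*} [CommRing A] [CommRing B]

theorem map_esymmAt (φ : A →+* B) (s : Finset ι) (n : ℕ) (f : ι → A) :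
    φ (esymmAt s n f) = esymmAt s n (fun i => φ (f i)) := by
  simp [esymmAt, map_sum, map_prod]

theorem esymmAt_eq_aeval_esymm [Fintype ι] (n : ℕ) (f : ι → A) :
    esymmAt Finset.univ n f = aeval f (esymm ι ℤ n) := by
  simp [esymmAt, esymm, map_sum, map_prod]

theorem esymmAt_eq_zero_of_card_lt (s : Finset ι) {n : ℕ} (hn : s.card < n) (f : ι → A) :
    esymmAt s n f = 0 := by
  simp [esymmAt, Finset.powersetCard_eq_empty.mpr hn]

theorem isNewtonPair_esymmAt [Fintype ι] (f : ι → A) :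
    IsNewtonPair (fun n => esymmAt Finset.univ n f) (fun n => ∑ i, f i ^ n) := by
  have h : IsNewtonPair (fun n => esymm ι ℤ n) (fun n => psum ι ℤ n) := by
    intro k hk
    dsimp only
    rw [psum_eq_mul_esymm_sub_sum ι ℤ k hk, sub_eq_add_neg, add_comm, ← Finset.sum_neg_distrib]
    congr 1
    refine Finset.sum_bij' (fun a _ => a.1) (fun i _ => (i, k - i)) ?_ ?_ ?_ ?_ ?_
    · rintro ⟨a, b⟩ h
      simp at h ⊢
      omega
    · intro i h
      simp at h ⊢
      omega
    · rintro ⟨a, b⟩ h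
      simp at h ⊢
      omega
    · intro i h
      rfl
    · rintro ⟨a, b⟩ h
      simp at h
      obtain ⟨rfl, h⟩ := h
      simp [pow_succ, mul_assoc]
  simpa [esymmAt_eq_aeval_esymm, psum, map_sum] using
    h.map (aeval f : MvPolynomial ι ℤ →ₐ[ℤ] A).toRingHom

theorem prod_one_add_C_mul_X (s : Finset ι) (f : ι → A) (c : A) :
    ∏ i ∈ s, (1 + Polynomial.C (f i * c) * Polynomial.X) =
      ∑ n ∈ Finset.range (s.card + 1), Polynomial.C (esymmAt s n f * c ^ n) * Polynomial.X ^ n := by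
  rw [Finset.prod_one_add, Finset.sum_powerset]
  refine Finset.sum_congr rfl fun n _ => ?_
  rw [esymmAt, Finset.sum_mul, map_sum, Finset.sum_mul]
  refine Finset.sum_congr rfl fun t ht => ?_
  rw [Finset.prod_mul_distrib, Finset.prod_const, (Finset.mem_powersetCard.mp ht).2, ← map_prod,
    Finset.prod_mul_distrib, Finset.prod_const, (Finset.mem_powersetCard.mp ht).2]

theorem coeff_prod_one_add_C_mul_X (s : Finset ι) (f : ι → A) (n : ℕ) :
    (∏ i ∈ s, (1 + Polynomial.C (f i) * Polynomial.X)).coeff n = esymmAt s n f := by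
  have := prod_one_add_C_mul_X s f 1
  simp only [mul_one, one_pow] at this
  rw [this, Polynomial.finsetSum_coeff]
  simp only [Polynomial.coeff_C_mul_X_pow]
  rw [Finset.sum_ite_eq]
  split_ifs with h
  · rfl
  · rw [esymmAt_eq_zero_of_card_lt]
    simpa using h

end Elementary

theorem map_aeval_sumElim {A B σ τ : Type*} [CommRing A] [CommRing B] [Algebra ℤ A]
    [Algebra ℤ B] (f : A →+* B) (a : σ → A)
    (b : τ → A) (P : MvPolynomial (σ ⊕ τ) ℤ) :
    f (aeval (Sum.elim a b) P) = aeval (Sum.elim (fun i => f (a i)) fun i => f (b i)) P := by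
  let g : A →ₐ[ℤ] B := { f with commutes' := fun n => by simp }
  refine (comp_aeval_apply (Sum.elim a b) g P).trans ?_
  congr 2
  ext (i | i) <;> rfl

theorem exists_isPk (k : ℕ) : ∃ P, IsPk k P := by
  let a : ℕ → MvPolynomial (Fin k) ℤ := fun i =>
    if i = 0 then 1 else if h : i - 1 < k then X ⟨i - 1, h⟩ else 0
  let F : Polynomial (MvPolynomial (Fin k) (MvPolynomial (Fin k) ℤ)) :=
    ∏ j : Fin k, ∑ i ∈ Finset.range (k + 1), Polynomial.C (C (a i) * X j ^ i) * Polynomial.X ^ i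
  have hF : (F.coeff k).IsSymmetric := by
    intro e
    have : F.map (rename e : MvPolynomial (Fin k) (MvPolynomial (Fin k) ℤ) →ₐ[_] _).toRingHom =
        F := by
      simp only [F, Polynomial.map_prod, Polynomial.map_sum]
      simp only [AlgHom.toRingHom_eq_coe, Polynomial.map_mul, Polynomial.map_C, Polynomial.map_pow,
        Polynomial.map_X, RingHom.coe_coe, map_mul, map_pow, rename_C, rename_X]
      exact Equiv.prod_comp e fun j => ∑ i ∈ Finset.range (k + 1),
        Polynomial.C (C (a i)) * Polynomial.C (X j) ^ i * Polynomial.X ^ i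
    conv_rhs => rw [← this]
    rw [Polynomial.coeff_map]
    rfl
  obtain ⟨H, hH⟩ := esymmAlgHom_surjective (σ := Fin k) (MvPolynomial (Fin k) ℤ) (n := k) (by simp)
    ⟨F.coeff k, hF⟩
  replace hH : aeval (fun i : Fin k => esymm (Fin k) (MvPolynomial (Fin k) ℤ) (i + 1)) H =
      F.coeff k := by
    rw [← esymmAlgHom_apply, hH]
  let x : Fin k → MvPolynomial (Fin k ⊕ Fin k) ℤ := fun j => X (Sum.inl j)
  let y : Fin k → MvPolynomial (Fin k ⊕ Fin k) ℤ := fun j => X (Sum.inr j)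
  let α : MvPolynomial (Fin k) ℤ →+* MvPolynomial (Fin k ⊕ Fin k) ℤ :=
    (aeval fun i : Fin k => esymmAt Finset.univ (i.1 + 1) x).toRingHom
  have hα (i : ℕ) (hi : i ≤ k) : α (a i) = esymmAt Finset.univ i x := by
    by_cases h0 : i = 0
    · simp [a, h0, esymmAt]
    · have h1 : i - 1 < k := by omega
      have h2 : i - 1 + 1 = i := by omega
      simp [a, h0, h1, α, h2]
  let Θ := eval₂Hom α y
  refine ⟨eval₂Hom (rename Sum.inl : MvPolynomial (Fin k) ℤ →ₐ[ℤ] _).toRingHom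
    (fun i => X (Sum.inr i)) H, ?_⟩
  have hΘ : aeval (Sum.elim (fun i : Fin k => esymmAt Finset.univ (i.1 + 1) x)
      (fun i : Fin k => esymmAt Finset.univ (i.1 + 1) y))
      (eval₂Hom (rename Sum.inl : MvPolynomial (Fin k) ℤ →ₐ[ℤ] _).toRingHom
        (fun i => X (Sum.inr i)) H) = Θ (F.coeff k) := by
    rw [← hH]
    clear hH
    induction H using MvPolynomial.induction_on with
    | C r => simp [Θ, α, bind₁_rename, Function.comp_def]
    | add p q hp hq => simp only [map_add, hp, hq]
    | mul_X p i hp =>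
      simp only [map_mul, hp]
      congr 1
      simp [Θ, y, esymm, esymmAt, map_sum, map_prod]
  rw [IsPk]
  change aeval (Sum.elim (fun i : Fin k => esymmAt Finset.univ (i.1 + 1) x)
      (fun i : Fin k => esymmAt Finset.univ (i.1 + 1) y)) _ =
    esymmAt Finset.univ k fun p : Fin k × Fin k => x p.1 * y p.2
  rw [hΘ, ← Polynomial.coeff_map, ← coeff_prod_one_add_C_mul_X, ← Finset.univ_product_univ,
    Finset.prod_product_right]
  congr 1
  simp only [F, Polynomial.map_prod, Polynomial.map_sum]
  refine Finset.prod_congr rfl fun j _ => ?_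
  rw [prod_one_add_C_mul_X, Finset.card_univ, Fintype.card_fin]
  refine Finset.sum_congr rfl fun i hi => ?_
  simp [Θ, hα i (by simpa [Nat.lt_succ_iff] using hi)]

theorem aeval_sumElim_esymmAt_injective (k : ℕ) :
    Function.Injective (aeval (Sum.elim
      (fun i : Fin k => esymmAt Finset.univ (i.1 + 1)
        (fun j : Fin k => (X (Sum.inl j) : MvPolynomial (Fin k ⊕ Fin k) ℚ)))
      (fun i : Fin k => esymmAt Finset.univ (i.1 + 1)
        (fun j : Fin k => (X (Sum.inr j) : MvPolynomial (Fin k ⊕ Fin k) ℚ)))) :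
      MvPolynomial (Fin k ⊕ Fin k) ℚ →ₐ[ℚ] MvPolynomial (Fin k ⊕ Fin k) ℚ) := by
  set φ := (aeval (Sum.elim
      (fun i : Fin k => esymmAt Finset.univ (i.1 + 1)
        (fun j : Fin k => (X (Sum.inl j) : MvPolynomial (Fin k ⊕ Fin k) ℚ)))
      (fun i : Fin k => esymmAt Finset.univ (i.1 + 1)
        (fun j : Fin k => (X (Sum.inr j) : MvPolynomial (Fin k ⊕ Fin k) ℚ)))) :
      MvPolynomial (Fin k ⊕ Fin k) ℚ →ₐ[ℚ] MvPolynomial (Fin k ⊕ Fin k) ℚ)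
  let inner : MvPolynomial (Fin k) ℚ →ₐ[ℚ] MvPolynomial (Fin k) ℚ :=
    aeval fun i : Fin k => esymm (Fin k) ℚ (i + 1)
  let outer : MvPolynomial (Fin k) (MvPolynomial (Fin k) ℚ) →ₐ[MvPolynomial (Fin k) ℚ]
      MvPolynomial (Fin k) (MvPolynomial (Fin k) ℚ) :=
    aeval fun i : Fin k => esymm (Fin k) (MvPolynomial (Fin k) ℚ) (i + 1)
  have hinner : Function.Injective inner := fun p q h =>
    esymmAlgHom_injective (σ := Fin k) ℚ (n := k) (by simp)
      (Subtype.ext (by simpa only [esymmAlgHom_apply] using h))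
  have houter : Function.Injective outer := fun p q h =>
    esymmAlgHom_injective (σ := Fin k) (MvPolynomial (Fin k) ℚ) (n := k) (by simp)
      (Subtype.ext (by simpa only [esymmAlgHom_apply] using h))
  let s := sumAlgEquiv ℚ (Fin k) (Fin k)
  have hcomp : s.toAlgHom.comp φ =
      ((outer.restrictScalars ℚ).comp (mapAlgHom inner)).comp s.toAlgHom := by
    ext1 i
    rcases i with i | i
    · simp [s, φ, outer, esymmAt, esymm, map_sum, map_prod, sumAlgEquiv_X_inl]
    · simp [s, φ, outer, inner, esymmAt, esymm, map_sum, map_prod, sumAlgEquiv_X_inr]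
  have hinj : Function.Injective (s.toAlgHom.comp φ) := by
    rw [hcomp]
    exact (houter.comp (map_injective _ hinner)).comp s.injective
  rw [AlgHom.coe_comp] at hinj
  exact hinj.of_comp

/-- Over a `ℚ`-algebra, `P_k` is determined by multiplicativity of the associated power sums. -/
theorem IsPk.aeval_eq_of_isNewtonPair {A : Type*} [CommRing A] [Algebra ℚ A] {k : ℕ} (hk : 1 ≤ k)
    {P : MvPolynomial (Fin k ⊕ Fin k) ℤ} (hP : IsPk k P) {a b c p q : ℕ → A}
    (ha : IsNewtonPair a p) (hb : IsNewtonPair b q) (hc : IsNewtonPair c fun n => p n * q n) :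
    aeval (Sum.elim (fun i : Fin k => a (i.1 + 1)) (fun i : Fin k => b (i.1 + 1))) P = c k := by
  let u : (Fin k → Fin k ⊕ Fin k) → ℕ → MvPolynomial (Fin k ⊕ Fin k) ℚ := fun f n =>
    if h : n - 1 < k then X (f ⟨n - 1, h⟩) else 0
  have hu (f : Fin k → Fin k ⊕ Fin k) (i : Fin k) : u f (i.1 + 1) = X (f i) := by simp [u]
  obtain ⟨p', hp'⟩ := exists_powerSum (u Sum.inl)
  obtain ⟨q', hq'⟩ := exists_powerSum (u Sum.inr)
  obtain ⟨c', hc'⟩ := exists_elementary fun n => p' n * q' n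
  let x : Fin k → MvPolynomial (Fin k ⊕ Fin k) ℚ := fun j => X (Sum.inl j)
  let y : Fin k → MvPolynomial (Fin k ⊕ Fin k) ℚ := fun j => X (Sum.inr j)
  let φ : MvPolynomial (Fin k ⊕ Fin k) ℚ →ₐ[ℚ] MvPolynomial (Fin k ⊕ Fin k) ℚ := aeval (Sum.elim
    (fun i : Fin k => esymmAt Finset.univ (i.1 + 1) x)
    (fun i : Fin k => esymmAt Finset.univ (i.1 + 1) y))
  have hPc : map (Int.castRingHom ℚ) P = c' k := by
    apply aeval_sumElim_esymmAt_injective k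
    change φ _ = φ _
    have h1 : ∀ n, 1 ≤ n → n ≤ k → φ (p' n) = ∑ i, x i ^ n :=
      (hp'.map φ.toRingHom).powerSum_unique (isNewtonPair_esymmAt x) fun n hn hnk => by
        obtain ⟨m, rfl⟩ := Nat.exists_eq_add_of_le' hn
        simp [hu Sum.inl ⟨m, hnk⟩, φ]
    have h2 : ∀ n, 1 ≤ n → n ≤ k → φ (q' n) = ∑ i, y i ^ n :=
      (hq'.map φ.toRingHom).powerSum_unique (isNewtonPair_esymmAt y) fun n hn hnk => by
        obtain ⟨m, rfl⟩ := Nat.exists_eq_add_of_le' hn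
        simp [hu Sum.inr ⟨m, hnk⟩, φ]
    have h3 : φ (c' k) = esymmAt Finset.univ k fun r : Fin k × Fin k => x r.1 * y r.2 :=
      (hc'.map φ.toRingHom).elementary_unique
        (isNewtonPair_esymmAt fun r : Fin k × Fin k => x r.1 * y r.2) (n := k)
        (fun n hn hnk => by
          have := congrArg₂ (· * ·) (h1 n hn hnk) (h2 n hn hnk)
          simp only [Finset.sum_mul_sum, ← mul_pow] at this
          rw [Fintype.sum_prod_type]
          simpa using this) k hk le_rfl
    rw [h3]
    have h4 := congrArg (map (Int.castRingHom ℚ)) hP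
    rw [map_esymmAt] at h4
    simp only [map_mul, map_X] at h4
    rw [← h4, map_aeval_sumElim, ← algebraMap_int_eq]
    simp only [φ, aeval_map_algebraMap, map_esymmAt, map_X, x, y]
  let θ : MvPolynomial (Fin k ⊕ Fin k) ℚ →ₐ[ℚ] A :=
    aeval (Sum.elim (fun i : Fin k => a (i.1 + 1)) (fun i : Fin k => b (i.1 + 1)))
  have h1 : ∀ n, 1 ≤ n → n ≤ k → θ (p' n) = p n :=
    (hp'.map θ.toRingHom).powerSum_unique ha fun n hn hnk => by
      obtain ⟨m, rfl⟩ := Nat.exists_eq_add_of_le' hn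
      simp [hu Sum.inl ⟨m, hnk⟩, θ]
  have h2 : ∀ n, 1 ≤ n → n ≤ k → θ (q' n) = q n :=
    (hq'.map θ.toRingHom).powerSum_unique hb fun n hn hnk => by
      obtain ⟨m, rfl⟩ := Nat.exists_eq_add_of_le' hn
      simp [hu Sum.inr ⟨m, hnk⟩, θ]
  have h3 : θ (c' k) = c k :=
    (hc'.map θ.toRingHom).elementary_unique hc (n := k)
      (fun n hn hnk => by simp [h1 n hn hnk, h2 n hn hnk]) k hk le_rfl
  rw [← h3, ← hPc]
  exact (aeval_map_algebraMap ℚ _ P).symm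

/-- The polynomials `P_k` turn products of power sums into products. -/
theorem isNewtonPair_mul_of_isPk {R : Type*} [CommRing R] {P : ∀ k, MvPolynomial (Fin k ⊕ Fin k) ℤ}
    (hP : ∀ k, IsPk k (P k)) {a b p q : ℕ → R} (ha : IsNewtonPair a p) (hb : IsNewtonPair b q) :
    ∃ r, IsNewtonPair (fun k => aeval (Sum.elim (fun i : Fin k => a (i.1 + 1))
      (fun i : Fin k => b (i.1 + 1))) (P k)) r ∧ ∀ k, 1 ≤ k → r k = p k * q k := by
  let x : ℕ → MvPolynomial (ℕ ⊕ ℕ) ℤ := fun n => X (Sum.inl n)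
  let y : ℕ → MvPolynomial (ℕ ⊕ ℕ) ℤ := fun n => X (Sum.inr n)
  let z : ℕ → MvPolynomial (ℕ ⊕ ℕ) ℤ := fun k => aeval (Sum.elim (fun i : Fin k => x (i.1 + 1))
    (fun i : Fin k => y (i.1 + 1))) (P k)
  obtain ⟨p', hp'⟩ := exists_powerSum x
  obtain ⟨q', hq'⟩ := exists_powerSum y
  obtain ⟨r', hr'⟩ := exists_powerSum z
  have hmul : ∀ k, 1 ≤ k → r' k = p' k * q' k := by
    intro k hk
    let ι : MvPolynomial (ℕ ⊕ ℕ) ℤ →+* MvPolynomial (ℕ ⊕ ℕ) ℚ := map (Int.castRingHom ℚ)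
    apply map_injective (Int.castRingHom ℚ) Int.cast_injective
    change ι _ = ι _
    obtain ⟨c, hc⟩ := exists_elementary fun n => ι (p' n) * ι (q' n)
    rw [map_mul]
    refine (hr'.map ι).powerSum_unique hc (n := k) (fun n hn _ => ?_) k hk le_rfl
    rw [← (hP n).aeval_eq_of_isNewtonPair hn (hp'.map ι) (hq'.map ι) hc]
    exact map_aeval_sumElim ι _ _ _
  let θ : MvPolynomial (ℕ ⊕ ℕ) ℤ →+* R := (aeval (Sum.elim a b) : MvPolynomial (ℕ ⊕ ℕ) ℤ →ₐ[ℤ] R).toRingHom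
  refine ⟨fun n => θ (r' n), ?_, fun k hk => ?_⟩
  · convert hr'.map θ using 2 with k
    simp only [z, map_aeval_sumElim]
    simp [θ, x, y]
  · dsimp only
    rw [hmul k hk, map_mul]
    congr 1
    · exact (hp'.map θ).powerSum_unique ha (n := k) (fun n _ _ => by simp [θ, x]) k hk le_rfl
    · exact (hq'.map θ).powerSum_unique hb (n := k) (fun n _ _ => by simp [θ, y]) k hk le_rfl

/-- the Adams operations `ψ^k` of a λ-ring, defined by `ψ^1 = id` and the Newton
recursion, are ring endomorphisms. -/
theorem stmt_5 {R : Type*} [CommRing R] (l : ℕ → R → R) (hl : IsLambdaRing l)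
    (ψ : ℕ → R → R)
    (hψ1 : ∀ x : R, ψ 1 x = x)
    (hψrec : ∀ k, 2 ≤ k → ∀ x : R, ψ k x =
      (∑ i ∈ Finset.Ico 1 k, (-1 : R) ^ (i + 1) * (l i x * ψ (k - i) x)) +
        (-1 : R) ^ (k + 1) * (k : R) * l k x) :
    ∀ k, 1 ≤ k →
      (ψ k (1 : R) = 1) ∧
      (∀ x y : R, ψ k (x + y) = ψ k x + ψ k y) ∧
      (∀ x y : R, ψ k (x * y) = ψ k x * ψ k y) := by
  have hN (x : R) : IsNewtonPair (fun n => l n x) (fun n => ψ n x) := by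
    intro k hk
    rcases hk.eq_or_lt with rfl | hk
    · simp [hψ1, hl.map_one]
    · exact hψrec k hk x
  have hone : ∀ k, 1 ≤ k → ψ k (1 : R) = 1 := by
    intro k hk
    induction k, hk using Nat.le_induction with
    | base => exact hψ1 1
    | succ k hk ih =>
      refine (hN 1 (k + 1) (by omega)).trans ?_
      dsimp only
      rw [hl.one_eq (k + 1) (by omega), mul_zero, add_zero,
        Finset.sum_eq_single 1]
      · simp [hl.map_one, ih]
      · intro i hi hi1
        rw [Finset.mem_Ico] at hi
        rw [hl.one_eq i (by omega)]
        simp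
      · intro h
        exact absurd (Finset.mem_Ico.mpr ⟨le_rfl, by omega⟩) h
  intro k hk
  refine ⟨hone k hk, fun x y => ?_, fun x y => ?_⟩
  · exact (hN (x + y)).powerSum_unique
      ((hN x).add (hN y) (hl.map_zero x) (hl.map_zero y)) (n := k)
      (fun n _ _ => hl.add_eq n x y) k hk le_rfl
  · choose P hP using exists_isPk
    obtain ⟨r, hr, hmul⟩ := isNewtonPair_mul_of_isPk hP (hN x) (hN y)
    rw [← hmul k hk]
    exact (hN (x * y)).powerSum_unique hr (n := k)
      (fun n hn _ => hl.mul_eq n hn (P n) (hP n) x y) k hk le_rfl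
end

section
/- Let R be a commutative ring, L an invertible R-module (a finitely generated projective R-module of rank one, equivalently an R-module L for which there exists an R-module L' with L ⊗_R L' ≅ R), and M an arbitrary R-module. Then for every n ≥ 0 there is an isomorphism of R-modules ⋀^n_R(L ⊗_R M) ≅ L^{⊗n} ⊗_R ⋀^n_R(M), natural in M, induced by (l_1 ⊗ ⋯ ⊗ l_n) ⊗ (m_1 ∧ ⋯ ∧ m_n) ↦ (l_1 ⊗ m_1) ∧ ⋯ ∧ (l_n ⊗ m_n). -/
open TensorProduct PiTensorProduct

/-- The wedge `m_1 ∧ ⋯ ∧ m_n`, as an element of the `n`-th exterior power `⋀[R]^n M`. -/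
noncomputable def wedgeιMulti (R : Type) {M : Type} [CommRing R] [AddCommGroup M] [Module R M]
    (n : ℕ) (m : Fin n → M) : ⋀[R]^n M :=
  ⟨ExteriorAlgebra.ιMulti R n m, ExteriorAlgebra.ιMulti_range R n ⟨m, rfl⟩⟩

/-- The map `⋀^n f : ⋀[R]^n M →ₗ[R] ⋀[R]^n N` induced by a linear map `f : M →ₗ[R] N`. -/
noncomputable def extPowerMap {R M N : Type} [CommRing R] [AddCommGroup M] [Module R M]
    [AddCommGroup N] [Module R N] (n : ℕ) (f : M →ₗ[R] N) :
    ⋀[R]^n M →ₗ[R] ⋀[R]^n N :=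
  (ExteriorAlgebra.map f).toLinearMap.restrict (p := ⋀[R]^n M) (q := ⋀[R]^n N)
    (fun x hx => by
      rw [← ExteriorAlgebra.ιMulti_span_fixedDegree] at hx ⊢
      induction hx using Submodule.span_induction with
      | mem y hy =>
          obtain ⟨m, rfl⟩ := hy
          exact Submodule.subset_span ⟨f ∘ m, (ExteriorAlgebra.map_apply_ιMulti f m).symm⟩
      | zero => simp
      | add y z _ _ hy hz => rw [map_add]; exact Submodule.add_mem _ hy hz
      | smul a y _ hy => rw [map_smul]; exact Submodule.smul_mem _ a hy)

namespace Module.Invertible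

variable {R L : Type*} [CommRing R] [AddCommGroup L] [Module R L] [Module.Invertible R L]

theorem span_range_dual_apply_eq_top :
    Ideal.span (Set.range fun p : Module.Dual R L × L ↦ p.1 p.2) = ⊤ := by
  rw [Ideal.eq_top_iff_one]
  obtain ⟨t, ht⟩ := (Module.Invertible.bijective (R := R) (M := L)).surjective 1
  rw [← ht]
  clear ht
  induction t with
  | zero => simp
  | tmul f a => exact Ideal.subset_span ⟨(f, a), by simp⟩
  | add x y hx hy => rw [map_add]; exact add_mem hx hy

theorem eq_zero_of_dual_apply_pow_smul {N : Type*} [AddCommGroup N] [Module R N] (n : ℕ) {x : N}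
    (h : ∀ (f : Module.Dual R L) (a : L), f a ^ n • x = 0) : x = 0 := by
  have htop := Ideal.span_pow_eq_top _ (span_range_dual_apply_eq_top (R := R) (L := L)) n
  have hle : (⊤ : Ideal R) ≤ LinearMap.ker (LinearMap.toSpanSingleton R N x) := by
    rw [← htop, Ideal.span_le]
    rintro _ ⟨_, ⟨⟨f, a⟩, rfl⟩, rfl⟩
    simpa using h f a
  simpa using hle (show (1 : R) ∈ ⊤ from trivial)

theorem dual_apply_smul_comm (f : Module.Dual R L) (x y : L) : f x • y = f y • x := by
  simpa using congrArg (TensorProduct.lid R L ∘ f.rTensor L)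
    (tmul_comm (R := R) (m₁ := x) (m₂ := y))

end Module.Invertible

namespace exteriorPower

open Module.Invertible

variable {R L M : Type*} [CommRing R] [AddCommGroup L] [Module R L]
  [AddCommGroup M] [Module R M] {n : ℕ}

theorem dual_apply_pow_smul_ιMulti_tmul [Module.Invertible R L] (f : Module.Dual R L) (a : L)
    (l : Fin n → L) (m : Fin n → M) :
    f a ^ n • ιMulti R n (fun i ↦ l i ⊗ₜ[R] m i) =
      (∏ i, f (l i)) • ιMulti R n (fun i ↦ a ⊗ₜ[R] m i) := by
  have h₁ := (ιMulti R n).toMultilinearMap.map_smul_univ (fun _ ↦ f a) (fun i ↦ l i ⊗ₜ[R] m i)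
  have h₂ := (ιMulti R n).toMultilinearMap.map_smul_univ (fun i ↦ f (l i)) (fun i ↦ a ⊗ₜ[R] m i)
  simp only [smul_tmul', dual_apply_smul_comm f a, Finset.prod_const, Finset.card_univ,
    Fintype.card_fin] at h₁ h₂
  exact h₁.symm.trans h₂

variable (R L M n) in
/-- The map `(l, m) ↦ (l_1 ⊗ m_1) ∧ ⋯ ∧ (l_n ⊗ m_n)`, multilinear in `l` and alternating
in `m`. -/
noncomputable def ιMultiTmul [Module.Invertible R L] :
    MultilinearMap R (fun _ : Fin n ↦ L) (M [⋀^Fin n]→ₗ[R] ⋀[R]^n (L ⊗[R] M)) where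
  toFun l :=
    { (ιMulti R n).toMultilinearMap.compLinearMap (fun i ↦ TensorProduct.mk R L M (l i)) with
      map_eq_zero_of_eq' := fun m i j hm hij ↦ by
        refine eq_zero_of_dual_apply_pow_smul (R := R) (L := L) n fun f a ↦ ?_
        refine (dual_apply_pow_smul_ιMulti_tmul f a l m).trans ?_
        rw [(ιMulti R n).map_eq_zero_of_eq _ (by rw [hm]) hij, smul_zero] }
  map_update_add' l i x y := by
    ext1 m
    have h (z : L) : (fun k ↦ Function.update l i z k ⊗ₜ[R] m k) =
        Function.update (fun k ↦ l k ⊗ₜ[R] m k) i (z ⊗ₜ[R] m i) := by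
      ext k
      rcases eq_or_ne k i with rfl | hk <;> simp [*]
    change ιMulti R n (fun k ↦ Function.update l i (x + y) k ⊗ₜ[R] m k) =
      ιMulti R n (fun k ↦ Function.update l i x k ⊗ₜ[R] m k) +
      ιMulti R n (fun k ↦ Function.update l i y k ⊗ₜ[R] m k)
    rw [h, h, h, add_tmul, AlternatingMap.map_update_add]
  map_update_smul' l i c x := by
    ext1 m
    have h (z : L) : (fun k ↦ Function.update l i z k ⊗ₜ[R] m k) =
        Function.update (fun k ↦ l k ⊗ₜ[R] m k) i (z ⊗ₜ[R] m i) := by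
      ext k
      rcases eq_or_ne k i with rfl | hk <;> simp [*]
    change ιMulti R n (fun k ↦ Function.update l i (c • x) k ⊗ₜ[R] m k) =
      c • ιMulti R n (fun k ↦ Function.update l i x k ⊗ₜ[R] m k)
    rw [h, h, ← smul_tmul', AlternatingMap.map_update_smul]

variable (R L M n) in
/-- The canonical map `L^{⊗n} ⊗ ⋀^n M → ⋀^n (L ⊗ M)` for an invertible module `L`. -/
noncomputable def tensorToExteriorPower [Module.Invertible R L] :
    (⨂[R]^n L) ⊗[R] (⋀[R]^n M) →ₗ[R] ⋀[R]^n (L ⊗[R] M) :=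
  TensorProduct.lift
    (alternatingMapLinearEquiv.toLinearMap ∘ₗ PiTensorProduct.lift (ιMultiTmul R L M n))

@[simp]
theorem tensorToExteriorPower_tprod_tmul_ιMulti [Module.Invertible R L]
    (l : Fin n → L) (m : Fin n → M) :
    tensorToExteriorPower R L M n (PiTensorProduct.tprod R l ⊗ₜ ιMulti R n m) =
      ιMulti R n (fun i ↦ l i ⊗ₜ[R] m i) := by
  simp only [tensorToExteriorPower, TensorProduct.lift.tmul, LinearMap.comp_apply,
    PiTensorProduct.lift.tprod, LinearEquiv.coe_coe, alternatingMapLinearEquiv_apply_ιMulti]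
  rfl

theorem tensorPower_tmul_ext {N : Type*} [AddCommGroup N] [Module R N]
    {φ ψ : (⨂[R]^n L) ⊗[R] (⋀[R]^n M) →ₗ[R] N}
    (h : ∀ (l : Fin n → L) (m : Fin n → M),
      φ (PiTensorProduct.tprod R l ⊗ₜ ιMulti R n m) =
        ψ (PiTensorProduct.tprod R l ⊗ₜ ιMulti R n m)) : φ = ψ := by
  apply TensorProduct.ext
  apply PiTensorProduct.ext
  ext1 l
  apply exteriorPower.linearMap_ext
  ext1 m
  exact h l m

theorem tensorToExteriorPower_surjective [Module.Invertible R L] :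
    Function.Surjective (tensorToExteriorPower R L M n) := by
  rw [← LinearMap.range_eq_top, ← top_le_iff,
    ← ιMulti_span_of_span R n (L ⊗[R] M) (TensorProduct.span_tmul_eq_top R L M),
    Submodule.span_le]
  rintro _ ⟨w, hw, rfl⟩
  choose l m h using fun i ↦ hw (Set.mem_range_self i)
  exact ⟨PiTensorProduct.tprod R l ⊗ₜ ιMulti R n m, by simp [h]⟩

variable (M n) in
/-- The map `⋀^n (L ⊗ M) → L^{⊗n} ⊗ ⋀^n M` sending `(l_1 ⊗ m_1) ∧ ⋯ ∧ (l_n ⊗ m_n)` to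
`(f l_1 ⋯ f l_n) • (a ⊗ ⋯ ⊗ a) ⊗ (m_1 ∧ ⋯ ∧ m_n)`. -/
noncomputable def exteriorPowerToTensor (f : Module.Dual R L) (a : L) :
    ⋀[R]^n (L ⊗[R] M) →ₗ[R] (⨂[R]^n L) ⊗[R] (⋀[R]^n M) :=
  TensorProduct.mk R _ _ (PiTensorProduct.tprod R fun _ ↦ a) ∘ₗ
    map n ((TensorProduct.lid R M).toLinearMap ∘ₗ f.rTensor M)

theorem exteriorPowerToTensor_tensorToExteriorPower [Module.Invertible R L]
    (f : Module.Dual R L) (a : L) (x : (⨂[R]^n L) ⊗[R] (⋀[R]^n M)) :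
    exteriorPowerToTensor M n f a (tensorToExteriorPower R L M n x) = f a ^ n • x := by
  suffices h : exteriorPowerToTensor M n f a ∘ₗ tensorToExteriorPower R L M n =
      f a ^ n • LinearMap.id from DFunLike.congr_fun h x
  refine tensorPower_tmul_ext fun l m ↦ ?_
  have h₁ := (ιMulti R n).toMultilinearMap.map_smul_univ (fun i ↦ f (l i)) m
  have h₂ := (PiTensorProduct.tprod R).map_smul_univ (fun i ↦ f (l i)) (fun _ ↦ a)
  have h₃ := (PiTensorProduct.tprod R).map_smul_univ (fun _ ↦ f a) l
  simp only [← dual_apply_smul_comm f a, Finset.prod_const, Finset.card_univ,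
    Fintype.card_fin] at h₂ h₃
  have h₄ : (((TensorProduct.lid R M).toLinearMap ∘ₗ f.rTensor M) ∘ fun i ↦ l i ⊗ₜ[R] m i) =
      fun i ↦ f (l i) • m i := by
    ext i; simp
  rw [LinearMap.comp_apply, tensorToExteriorPower_tprod_tmul_ιMulti, exteriorPowerToTensor,
    LinearMap.comp_apply, map_apply_ιMulti, h₄, TensorProduct.mk_apply]
  refine (congrArg _ h₁).trans ?_
  rw [tmul_smul, smul_tmul', ← h₂, h₃, ← smul_tmul']
  rfl

theorem tensorToExteriorPower_injective [Module.Invertible R L] :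
    Function.Injective (tensorToExteriorPower R L M n) := by
  rw [injective_iff_map_eq_zero]
  intro x hx
  refine eq_zero_of_dual_apply_pow_smul (R := R) (L := L) n fun f a ↦ ?_
  rw [← exteriorPowerToTensor_tensorToExteriorPower, hx, map_zero]

theorem tensorToExteriorPower_naturality [Module.Invertible R L] {N : Type*} [AddCommGroup N]
    [Module R N] (f : M →ₗ[R] N) :
    tensorToExteriorPower R L N n ∘ₗ (map n f).lTensor (⨂[R]^n L) =
      map n (f.lTensor L) ∘ₗ tensorToExteriorPower R L M n := by
  refine tensorPower_tmul_ext fun l m ↦ ?_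
  simp [Function.comp_def]

end exteriorPower

theorem extPowerMap_eq_map {R M N : Type} [CommRing R] [AddCommGroup M] [Module R M]
    [AddCommGroup N] [Module R N] (n : ℕ) (f : M →ₗ[R] N) :
    extPowerMap n f = exteriorPower.map n f := by
  ext m
  simp only [LinearMap.compAlternatingMap_apply, exteriorPower.map_apply_ιMulti]
  exact ExteriorAlgebra.map_apply_ιMulti f m

/-- for an invertible `R`-module `L` (i.e. `L ⊗ L' ≅ R` for some `L'`) and any
`R`-module `M`, there is an isomorphism `L^{⊗n} ⊗ ⋀^n M ≅ ⋀^n (L ⊗ M)`, natural in `M`,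
given on generators by `(l_1 ⊗ ⋯ ⊗ l_n) ⊗ (m_1 ∧ ⋯ ∧ m_n) ↦ (l_1 ⊗ m_1) ∧ ⋯ ∧ (l_n ⊗ m_n)`. -/
theorem stmt_9 (R : Type) [CommRing R] (L : Type) [AddCommGroup L] [Module R L]
    (hL : ∃ L' : ModuleCat.{0} R, Nonempty ((L ⊗[R] L') ≃ₗ[R] R))
    (n : ℕ) :
    ∃ e : (M : Type) → [inst : AddCommGroup M] → [inst2 : Module R M] →
        (((⨂[R]^n L) ⊗[R] (⋀[R]^n M)) ≃ₗ[R] (⋀[R]^n (L ⊗[R] M))),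
      (∀ (M : Type) [AddCommGroup M] [Module R M] (l : Fin n → L) (m : Fin n → M),
        e M ((PiTensorProduct.tprod R l) ⊗ₜ[R] wedgeιMulti R n m) =
          wedgeιMulti R n (fun i => l i ⊗ₜ[R] m i)) ∧
      (∀ (M : Type) [AddCommGroup M] [Module R M] (N : Type) [AddCommGroup N] [Module R N]
        (f : M →ₗ[R] N) (x : (⨂[R]^n L) ⊗[R] (⋀[R]^n M)),
        e N (LinearMap.lTensor (⨂[R]^n L) (extPowerMap n f) x) =
          extPowerMap n (LinearMap.lTensor L f) (e M x)) := by
  obtain ⟨L', ⟨e⟩⟩ := hL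
  have : Module.Invertible R L := .left e
  refine ⟨fun M _ _ ↦ .ofBijective (exteriorPower.tensorToExteriorPower R L M n)
    ⟨exteriorPower.tensorToExteriorPower_injective,
      exteriorPower.tensorToExteriorPower_surjective⟩, ?_, ?_⟩
  · intro M _ _ l m
    exact exteriorPower.tensorToExteriorPower_tprod_tmul_ιMulti l m
  · intro M _ _ N _ _ f x
    simp only [extPowerMap_eq_map]
    exact DFunLike.congr_fun (exteriorPower.tensorToExteriorPower_naturality f) x
end

section
/- Let R be a commutative ring and let W_1 ⊆ W_2 ⊆ U_1 ⊆ ⋯ ⊆ U_l be a chain of finitely generated projective R-modules in which each inclusion is split (each module is a direct summand of the next). Then the sequence of R-modules Λ^{l+1}(W_1, U_1, …, U_l) → Λ^{l+1}(W_2, U_1, …, U_l) → Λ^{l+1}(W_2/W_1, U_1/W_1, …, U_l/W_1), whose first map is induced by the inclusion W_1 ↪ W_2 and whose second map is induced by the quotient maps modulo W_1, is short exact: the first map is injective, the second is surjective, and the kernel of the second equals the image of the first. -/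
open TensorProduct PiTensorProduct

/-- The subrelation module defining the multi-exterior power `Λ^{k+1}(M_0,…,M_k)` of a family
of submodules of `V`: the span of the simple tensors `m_0 ⊗ ⋯ ⊗ m_k` in which two consecutive
entries are equal (as elements of the ambient module `V`). -/
noncomputable def multiExtRel {R V : Type} [CommRing R] [AddCommGroup V] [Module R V]
    {k : ℕ} (M : Fin (k + 1) → Submodule R V) : Submodule R (⨂[R] i, ↥(M i)) :=
  Submodule.span R {x | ∃ m : (i : Fin (k + 1)) → ↥(M i),
    (∃ i : Fin k, ((m i.castSucc : V) = (m i.succ : V))) ∧ x = tprod R m}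

/-- The multi-exterior power `Λ^{k+1}(M_0,…,M_k)` of a chain of submodules of `V`: the
quotient of `M_0 ⊗ ⋯ ⊗ M_k` by the span of the simple tensors with two equal consecutive
entries. -/
noncomputable abbrev multiExt {R V : Type} [CommRing R] [AddCommGroup V] [Module R V]
    {k : ℕ} (M : Fin (k + 1) → Submodule R V) : Type :=
  (⨂[R] i, ↥(M i)) ⧸ multiExtRel M

/-- The map of multi-exterior powers induced by a linear map of ambient modules carrying each
member of the first chain into the corresponding member of the second chain. -/
noncomputable def multiExtMap {R V V' : Type} [CommRing R] [AddCommGroup V] [Module R V]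
    [AddCommGroup V'] [Module R V'] {k : ℕ} (M : Fin (k + 1) → Submodule R V)
    (N : Fin (k + 1) → Submodule R V') (f : V →ₗ[R] V')
    (h : ∀ i, ∀ x : V, x ∈ M i → f x ∈ N i) :
    multiExt M →ₗ[R] multiExt N :=
  Submodule.mapQ _ _ (PiTensorProduct.map fun i => f.restrict (h i))
    (by
      unfold multiExtRel
      rw [Submodule.span_le]
      rintro x ⟨m, ⟨i, hi⟩, rfl⟩
      simp only [SetLike.mem_coe, Submodule.mem_comap, PiTensorProduct.map_tprod]
      refine Submodule.subset_span ⟨fun j => (f.restrict (h j)) (m j), ⟨i, ?_⟩, rfl⟩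
      simpa using congrArg f hi)

section Chains

variable {R V : Type} [CommRing R] [AddCommGroup V] [Module R V] {l : ℕ}

/-- The chain `(W₁, U₁, …, U_l)`, where `W₁ = F 0` and `U_j = F (j+1)` for `j ≥ 1`. -/
noncomputable def chainA (F : Fin (l + 2) → Submodule R V) : Fin (l + 1) → Submodule R V :=
  Fin.cons (F 0) (fun j : Fin l => F j.succ.succ)

/-- The chain `(W₂, U₁, …, U_l)`, where `W₂ = F 1`. -/
noncomputable def chainB (F : Fin (l + 2) → Submodule R V) : Fin (l + 1) → Submodule R V :=
  Fin.cons (F 1) (fun j : Fin l => F j.succ.succ)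

/-- The chain `(W₂/W₁, U₁/W₁, …, U_l/W₁)` of submodules of `V ⧸ W₁`. -/
noncomputable def chainC (F : Fin (l + 2) → Submodule R V) :
    Fin (l + 1) → Submodule R (V ⧸ F 0) :=
  fun i => (chainB F i).map (F 0).mkQ

end Chains

section Basic

variable {R V N : Type} [CommRing R] [AddCommGroup V] [Module R V] [AddCommGroup N] [Module R N]
  {k : ℕ} {M : Fin (k + 1) → Submodule R V}

/-- The universal multilinear map to the multi-exterior power. -/
noncomputable def multiExtMk (M : Fin (k + 1) → Submodule R V) :
    MultilinearMap R (fun i => ↥(M i)) (multiExt M) :=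
  (multiExtRel M).mkQ.compMultilinearMap (tprod R)

theorem multiExtMk_eq_zero (m : ∀ i, M i) (i : Fin k)
    (h : (m i.castSucc : V) = m i.succ) : multiExtMk M m = 0 :=
  (Submodule.Quotient.mk_eq_zero _).2 (Submodule.subset_span ⟨m, ⟨i, h⟩, rfl⟩)

/-- The linear map out of a multi-exterior power induced by a multilinear map vanishing on
families with two equal consecutive entries. -/
noncomputable def multiExtLift (f : MultilinearMap R (fun i => ↥(M i)) N)
    (hf : ∀ (m : ∀ i, M i) (i : Fin k), (m i.castSucc : V) = m i.succ → f m = 0) :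
    multiExt M →ₗ[R] N :=
  (multiExtRel M).liftQ (PiTensorProduct.lift f) (by
    rw [multiExtRel, Submodule.span_le]
    rintro x ⟨m, ⟨i, hi⟩, rfl⟩
    simpa using hf m i hi)

theorem multiExtLift_mk (f : MultilinearMap R (fun i => ↥(M i)) N)
    (hf : ∀ (m : ∀ i, M i) (i : Fin k), (m i.castSucc : V) = m i.succ → f m = 0)
    (m : ∀ i, M i) : multiExtLift f hf (multiExtMk M m) = f m := by
  simp [multiExtLift, multiExtMk]

theorem multiExt_hom_ext {f g : multiExt M →ₗ[R] N}
    (h : ∀ m, f (multiExtMk M m) = g (multiExtMk M m)) : f = g := by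
  refine Submodule.linearMap_qext _ (PiTensorProduct.ext (MultilinearMap.ext fun m => ?_))
  exact h m

theorem multiExtMap_mk {V' : Type} [AddCommGroup V'] [Module R V']
    {M' : Fin (k + 1) → Submodule R V'} (f : V →ₗ[R] V')
    (h : ∀ i, ∀ x : V, x ∈ M i → f x ∈ M' i) (m : ∀ i, M i) :
    multiExtMap M M' f h (multiExtMk M m) = multiExtMk M' fun i => ⟨f (m i), h i _ (m i).2⟩ := by
  simp only [multiExtMap, multiExtMk, LinearMap.compMultilinearMap_apply, Submodule.mkQ_apply,
    Submodule.mapQ_apply, PiTensorProduct.map_tprod]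
  rfl

theorem multiExtMk_swap (hM : ∀ i : Fin k, M i.castSucc ≤ M i.succ) (i : Fin k)
    (m m' : ∀ i, M i) (h₁ : (m' i.castSucc : V) = m i.succ)
    (h₂ : (m' i.succ : V) = m i.castSucc)
    (h : ∀ j, j ≠ i.castSucc → j ≠ i.succ → m' j = m j) :
    multiExtMk M m' = - multiExtMk M m := by
  have hne : i.castSucc ≠ i.succ := i.castSucc_lt_succ.ne
  let g (x y : M i.castSucc) : multiExt M :=
    multiExtMk M (Function.update (Function.update m i.castSucc x) i.succ
      (Submodule.inclusion (hM i) y))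
  have g_self (x) : g x x = 0 := multiExtMk_eq_zero _ i (by simp [hne])
  have g_add_right (x y z) : g x (y + z) = g x y + g x z := by
    simp only [g, map_add, MultilinearMap.map_update_add]
  have g_add_left (x y z) : g (x + y) z = g x z + g y z := by
    simp only [g, Function.update_comm hne, MultilinearMap.map_update_add]
  have hm : g (m i.castSucc) (m' i.castSucc) = multiExtMk M m := by
    refine congrArg (multiExtMk M) ?_
    rw [Function.update_eq_self, Function.update_eq_iff]
    exact ⟨Subtype.ext h₁, fun _ _ => rfl⟩
  have hm' : g (m' i.castSucc) (m i.castSucc) = multiExtMk M m' := by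
    refine congrArg (multiExtMk M) ?_
    rw [Function.update_eq_iff]
    refine ⟨Subtype.ext h₂.symm, fun j hj => ?_⟩
    by_cases hj' : j = i.castSucc
    · subst hj'; simp
    · rw [Function.update_of_ne hj', h j hj' hj]
  have := g_self (m i.castSucc + m' i.castSucc)
  rw [g_add_left, g_add_right, g_add_right, g_self, g_self, zero_add, add_zero, hm, hm'] at this
  exact eq_neg_of_add_eq_zero_right this

end Basic

section Free

variable {R V P ι : Type} [CommRing R] [AddCommGroup V] [Module R V] [AddCommGroup P] [Module R P]
  [LinearOrder ι] {k : ℕ} {M : Fin (k + 1) → Submodule R V}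

theorem exists_alternatingMap_strictMono {N : Type} [AddCommGroup N] [Module R N] {n : ℕ}
    (b : Module.Basis ι R P) (v : (Fin n → ι) → N) :
    ∃ r : P [⋀^Fin n]→ₗ[R] N, ∀ a, StrictMono a → r (b ∘ a) = v a := by
  let f : ⋀[R]^n P →ₗ[R] N := (b.exteriorPower n).constr R fun s =>
    v (Set.powersetCard.ofFinEmbEquiv.symm s)
  refine ⟨f.compAlternatingMap (exteriorPower.ιMulti R n), fun a ha => ?_⟩
  have := (b.exteriorPower n).constr_basis R
    (fun s => v (Set.powersetCard.ofFinEmbEquiv.symm s))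
    (Set.powersetCard.ofFinEmbEquiv (OrderEmbedding.ofStrictMono a ha))
  rw [exteriorPower.basis_apply] at this
  simpa [exteriorPower.ιMulti_family] using this

theorem exists_alternatingMap_of_basis [Finite ι] (hM : ∀ i : Fin k, M i.castSucc ≤ M i.succ)
    (b : Module.Basis ι R P) (e : P →ₗ[R] V) (S : Fin (k + 1) → Set ι)
    (hS : ∀ i, IsLowerSet (S i)) (hS' : ∀ i : Fin k, S i.castSucc ⊆ S i.succ)
    (he : ∀ i, ∀ a ∈ S i, e (b a) ∈ M i) :
    ∃ r : P [⋀^Fin (k + 1)]→ₗ[R] multiExt M, ∀ a : Fin (k + 1) → ι, ∀ ha : ∀ i, a i ∈ S i,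
      r (b ∘ a) = multiExtMk M fun i => ⟨e (b (a i)), he i _ (ha i)⟩ := by
  classical
  obtain ⟨r, hr⟩ := exists_alternatingMap_strictMono (N := multiExt M) b
    fun a : Fin (k + 1) → ι => if ha : ∀ i, a i ∈ S i then
      multiExtMk M fun i => ⟨e (b (a i)), he i _ (ha i)⟩ else 0
  refine ⟨r, fun a => ?_⟩
  induction h : toLex a using WellFoundedLT.induction generalizing a with
  | ind x ih =>
    subst h
    intro ha
    by_cases hmono : StrictMono a
    · rw [hr a hmono, dif_pos ha]
    obtain ⟨i, hi⟩ : ∃ i : Fin k, a i.succ ≤ a i.castSucc := by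
      simpa [Fin.strictMono_iff_lt_succ] using hmono
    have hne : i.castSucc ≠ i.succ := i.castSucc_lt_succ.ne
    obtain hi | hi := hi.eq_or_lt
    · rw [r.map_eq_zero_of_eq _ (by simp [hi]) hne]
      exact (multiExtMk_eq_zero _ i (by simp [hi])).symm
    · have ha' : ∀ j, (a ∘ Equiv.swap i.castSucc i.succ) j ∈ S j := by
        intro j
        by_cases h₁ : j = i.castSucc
        · subst h₁
          simpa using hS _ hi.le (ha _)
        by_cases h₂ : j = i.succ
        · subst h₂
          simpa using hS' _ (ha _)
        simpa [Equiv.swap_apply_of_ne_of_ne h₁ h₂] using ha j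
      have key := ih _ (Pi.lex_desc i.castSucc_lt_succ.le hi) _ rfl ha'
      rw [← Function.comp_assoc, r.map_swap _ hne] at key
      rw [← neg_inj, key]
      refine multiExtMk_swap hM i _ _ (by simp) (by simp) fun j h₁ h₂ => ?_
      simp [Equiv.swap_apply_of_ne_of_ne h₁ h₂]

theorem exists_alternatingMap_of_span [Finite ι] (hM : ∀ i : Fin k, M i.castSucc ≤ M i.succ)
    (b : Module.Basis ι R P) (e : P →ₗ[R] V) (S : Fin (k + 1) → Set ι)
    (hS : ∀ i, IsLowerSet (S i)) (hS' : ∀ i : Fin k, S i.castSucc ⊆ S i.succ)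
    (he : ∀ i, ∀ a ∈ S i, e (b a) ∈ M i) :
    ∃ r : P [⋀^Fin (k + 1)]→ₗ[R] multiExt M, ∀ x : Fin (k + 1) → P,
      (∀ i, x i ∈ Submodule.span R (b '' S i)) →
      ∀ m : ∀ i, M i, (∀ i, (m i : V) = e (x i)) → r x = multiExtMk M m := by
  obtain ⟨r, hr⟩ := exists_alternatingMap_of_basis hM b e S hS hS' he
  refine ⟨r, fun x hx m hm => ?_⟩
  let Q (i : Fin (k + 1)) : Submodule R P := Submodule.span R (Set.range fun a : S i => b a)
  have hQ (i) (y : P) (hy : y ∈ Q i) : e y ∈ M i := by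
    refine Submodule.span_le (p := (M i).comap e).2 ?_ hy
    rintro _ ⟨a, rfl⟩
    exact he i a a.2
  let B (i : Fin (k + 1)) : Module.Basis (S i) R (Q i) :=
    Module.Basis.span (b.linearIndependent.comp _ Subtype.val_injective)
  have key : r.toMultilinearMap.compLinearMap (fun i => (Q i).subtype) =
      (multiExtMk M).compLinearMap fun i => e.restrict (hQ i) := by
    refine Module.Basis.ext_multilinear B fun a => ?_
    have hB (i) : ((B i (a i) : Q i) : P) = b (a i) :=
      congrArg Subtype.val (Module.Basis.span_apply _ _)
    have := hr (fun i => a i) fun i => (a i).2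
    simp only [MultilinearMap.compLinearMap_apply, Submodule.subtype_apply, hB]
    refine this.trans (congrArg _ (funext fun i => Subtype.ext ?_))
    simp [hB]
  have hx' (i) : x i ∈ Q i := by simpa only [Q, ← Set.image_eq_range] using hx i
  have := DFunLike.congr_fun key fun i => ⟨x i, hx' i⟩
  refine this.trans (congrArg (multiExtMk M) (funext fun i => Subtype.ext ?_))
  simp [hm]

end Free

section Filtration

variable {R V : Type} [CommRing R] [AddCommGroup V] [Module R V] {n : ℕ}
  {F : Fin (n + 1) → Submodule R V}

theorem exists_retraction_of_split {A B c : Submodule R V} (hA : A ≤ B) (hc : c ≤ B)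
    (h : A ⊓ c = ⊥) (h' : A ⊔ c = B) : ∃ ρ : B →ₗ[R] A, ∀ x : B, ∀ hx : (x : V) ∈ A,
      ρ x = ⟨x, hx⟩ := by
  have hcompl : IsCompl (A.comap B.subtype) (c.comap B.subtype) := by
    constructor
    · rw [disjoint_iff, ← Submodule.comap_inf, h, ← LinearMap.ker, Submodule.ker_subtype]
    · rw [codisjoint_iff]
      refine Submodule.map_injective_of_injective B.injective_subtype ?_
      rw [Submodule.map_sup, Submodule.map_comap_subtype, Submodule.map_comap_subtype,
        Submodule.map_subtype_top, inf_eq_right.2 hA, inf_eq_right.2 hc, h']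
  refine ⟨(Submodule.comapSubtypeEquivOfLe hA).toLinearMap ∘ₗ
    Submodule.projectionOnto _ _ hcompl, fun x hx => ?_⟩
  have := Submodule.projectionOnto_apply_left hcompl ⟨x, hx⟩
  rw [LinearMap.comp_apply, this]
  rfl

theorem exists_retraction (hle : ∀ i : Fin n, F i.castSucc ≤ F i.succ)
    (hsplit : ∀ i : Fin n, ∃ c : Submodule R V,
      c ≤ F i.succ ∧ F i.castSucc ⊓ c = ⊥ ∧ F i.castSucc ⊔ c = F i.succ) (j : Fin (n + 1)) :
    ∃ E : F (Fin.last n) →ₗ[R] F j, ∀ (x : F (Fin.last n)) (hx : (x : V) ∈ F j), E x = ⟨x, hx⟩ := by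
  induction j using Fin.reverseInduction with
  | last => exact ⟨LinearMap.id, fun _ _ => rfl⟩
  | cast i ih =>
    obtain ⟨E, hE⟩ := ih
    obtain ⟨c, hc, h, h'⟩ := hsplit i
    obtain ⟨ρ, hρ⟩ := exists_retraction_of_split (hle i) hc h h'
    refine ⟨ρ ∘ₗ E, fun x hx => ?_⟩
    rw [LinearMap.comp_apply, hE x (hle i hx), hρ]

theorem exists_decomposition (hle : ∀ i : Fin n, F i.castSucc ≤ F i.succ)
    (hsplit : ∀ i : Fin n, ∃ c : Submodule R V,
      c ≤ F i.succ ∧ F i.castSucc ⊓ c = ⊥ ∧ F i.castSucc ⊔ c = F i.succ) :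
    ∃ D : ∀ j, F (Fin.last n) →ₗ[R] F j, (∀ x, ∑ j, (D j x : V) = x) ∧
      ∀ i (x : F (Fin.last n)), (x : V) ∈ F i → ∀ j, i < j → D j x = 0 := by
  choose E hE using exists_retraction hle hsplit
  have hmono : Monotone F := Fin.monotone_iff_le_succ.2 hle
  refine ⟨Fin.cons (E 0) fun j => E j.succ - Submodule.inclusion (hle j) ∘ₗ E j.castSucc,
    fun x => ?_, fun i x hx j hij => ?_⟩
  · rw [Fin.sum_univ_succ]
    simp only [Fin.cons_zero, Fin.cons_succ, LinearMap.sub_apply, LinearMap.comp_apply,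
      AddSubgroupClass.coe_sub, Submodule.coe_inclusion, Finset.sum_sub_distrib]
    have h₁ := Fin.sum_univ_succ fun j => (E j x : V)
    rw [Fin.sum_univ_castSucc, hE (Fin.last n) x x.2] at h₁
    rw [add_sub_assoc', ← h₁, add_sub_cancel_left]
  · induction j using Fin.cases with
    | zero => exact absurd hij (Fin.not_lt_zero i)
    | succ j =>
      rw [Fin.cons_succ, LinearMap.sub_apply, LinearMap.comp_apply, hE _ x (hmono hij.le hx),
        hE _ x (hmono (Fin.le_castSucc_iff.2 hij) hx)]
      exact sub_self _

/-- For a split filtration by finite projective modules, a multi-exterior power of members of the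
filtration is a retract of the exterior power of the top member. -/
theorem exists_alternatingMap_of_filtration
    (hfg : ∀ i, Module.Finite R (F i)) (hproj : ∀ i, Module.Projective R (F i))
    (hle : ∀ i : Fin n, F i.castSucc ≤ F i.succ)
    (hsplit : ∀ i : Fin n, ∃ c : Submodule R V,
      c ≤ F i.succ ∧ F i.castSucc ⊓ c = ⊥ ∧ F i.castSucc ⊔ c = F i.succ)
    {k : ℕ} (lev : Fin (k + 1) → Fin (n + 1)) (hlev : Monotone lev)
    {M : Fin (k + 1) → Submodule R V} (hM : ∀ i, M i = F (lev i)) :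
    ∃ r : F (Fin.last n) [⋀^Fin (k + 1)]→ₗ[R] multiExt M,
      ∀ (x : Fin (k + 1) → F (Fin.last n)) (m : ∀ i, M i), (∀ i, (x i : V) = m i) →
        r x = multiExtMk M m := by
  classical
  obtain ⟨D, hD, hD'⟩ := exists_decomposition hle hsplit
  have hmono : Monotone F := Fin.monotone_iff_le_succ.2 hle
  choose d q hq using fun j => Module.Finite.exists_fin' R (F j)
  choose σ hσ using fun j =>
    Module.projective_lifting_property (q j) LinearMap.id (hq j)
  let b : Module.Basis (Σₗ j, Fin (d j)) R (∀ j, Fin (d j) → R) :=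
    (Pi.basis fun j => Pi.basisFun R (Fin (d j))).reindex toLex
  let e : (∀ j, Fin (d j) → R) →ₗ[R] V :=
    ∑ j, (F j).subtype ∘ₗ q j ∘ₗ LinearMap.proj j
  let s : F (Fin.last n) →ₗ[R] (∀ j, Fin (d j) → R) := LinearMap.pi fun j => σ j ∘ₗ D j
  let S (i : Fin (k + 1)) : Set (Σₗ j, Fin (d j)) := {a | (ofLex a).1 ≤ lev i}
  have hes (x) : e (s x) = x := by
    have (j) (y) : q j (σ j y) = y := LinearMap.congr_fun (hσ j) y
    simp [e, s, this, hD]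
  have hs (i) (x : F (Fin.last n)) (hx : (x : V) ∈ F (lev i)) : s x ∈ Submodule.span R (b '' S i) := by
    rw [b.mem_span_image]
    intro a ha
    by_contra h
    refine (Finsupp.mem_support_iff.1 ha) ?_
    have : D (ofLex a).1 x = 0 := hD' _ x hx _ (not_le.1 h)
    simp [b, s, this]
  have he (i) (a) (ha : a ∈ S i) : e (b a) ∈ M i := by
    simp only [e, LinearMap.sum_apply]
    refine Submodule.sum_mem _ fun j _ => ?_
    rw [hM]
    by_cases hj : j ≤ lev i
    · exact hmono hj (q j _).2
    · have hne : j ≠ (ofLex a).1 := by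
        rintro rfl
        exact hj ha
      simp [b, Pi.basis_apply, hne]
  have hSlow (i) : IsLowerSet (S i) := by
    intro a a' h ha
    obtain h | ⟨h, -⟩ := Sigma.Lex.le_def.1 h
    · exact h.le.trans ha
    · exact h.le.trans ha
  obtain ⟨r, hr⟩ := exists_alternatingMap_of_span (M := M)
    (fun i => by simpa only [hM] using hmono (hlev i.castSucc_lt_succ.le)) b e S hSlow
    (fun i a (ha : _ ≤ lev _) => ha.trans (hlev i.castSucc_lt_succ.le)) he
  refine ⟨r.compLinearMap s, fun x m hx => hr _ (fun i => hs i _ ?_) m fun i => ?_⟩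
  · rw [← hM, hx]
    exact (m i).2
  · rw [hes, hx]

end Filtration

section Exact

variable {R V : Type} [CommRing R] [AddCommGroup V] [Module R V] {l : ℕ}
  {F : Fin (l + 2) → Submodule R V}

theorem chainA_apply (i : Fin (l + 1)) : chainA F i = F (Fin.succAbove 1 i) := by
  cases i using Fin.cases <;> rfl

theorem chainB_apply (i : Fin (l + 1)) : chainB F i = F i.succ := by
  cases i using Fin.cases <;> rfl

theorem multiExtMap_chainA_chainB_injective
    (hfg : ∀ i, Module.Finite R (F i)) (hproj : ∀ i, Module.Projective R (F i))
    (hle : ∀ i : Fin (l + 1), F i.castSucc ≤ F i.succ)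
    (hsplit : ∀ i : Fin (l + 1), ∃ c : Submodule R V,
      c ≤ F i.succ ∧ F i.castSucc ⊓ c = ⊥ ∧ F i.castSucc ⊔ c = F i.succ)
    (hAB : ∀ (i : Fin (l + 1)) (x : V), x ∈ chainA F i →
      LinearMap.id (R := R) x ∈ chainB F i) :
    Function.Injective (multiExtMap (chainA F) (chainB F) LinearMap.id hAB) := by
  obtain ⟨r, hr⟩ := exists_alternatingMap_of_filtration hfg hproj hle hsplit
    (Fin.succAbove 1) (Fin.strictMono_succAbove 1).monotone chainA_apply
  have hmono : Monotone F := Fin.monotone_iff_le_succ.2 hle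
  have hB (i) : chainB F i ≤ F (Fin.last (l + 1)) := by
    rw [chainB_apply]
    exact hmono (Fin.le_last _)
  let g : multiExt (chainB F) →ₗ[R] multiExt (chainA F) :=
    multiExtLift (r.toMultilinearMap.compLinearMap fun i => Submodule.inclusion (hB i))
      fun m i h => r.map_eq_zero_of_eq _ (Subtype.ext h) i.castSucc_lt_succ.ne
  have hg : g ∘ₗ multiExtMap (chainA F) (chainB F) LinearMap.id hAB = LinearMap.id := by
    refine multiExt_hom_ext fun m => ?_
    rw [LinearMap.comp_apply, multiExtMap_mk]
    exact (multiExtLift_mk _ _ _).trans (hr _ _ fun i => rfl)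
  exact Function.LeftInverse.injective (LinearMap.congr_fun hg)

theorem multiExtMk_mem_range (hle : ∀ i : Fin (l + 1), F i.castSucc ≤ F i.succ)
    (hAB : ∀ (i : Fin (l + 1)) (x : V), x ∈ chainA F i →
      LinearMap.id (R := R) x ∈ chainB F i)
    (i : Fin (l + 1)) (m : ∀ i, chainB F i) (hm : (m i : V) ∈ F 0) :
    multiExtMk (chainB F) m ∈
      LinearMap.range (multiExtMap (chainA F) (chainB F) LinearMap.id hAB) := by
  have hmono : Monotone F := Fin.monotone_iff_le_succ.2 hle
  induction i using Fin.induction generalizing m with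
  | zero =>
    have hA (i) : (m i : V) ∈ chainA F i := by
      cases i using Fin.cases with
      | zero => exact hm
      | succ j => exact (m j.succ).2
    refine ⟨multiExtMk _ fun i => ⟨m i, hA i⟩, ?_⟩
    rw [multiExtMap_mk]
    rfl
  | succ i ih =>
    have hB (i : Fin l) : chainB F i.castSucc ≤ chainB F i.succ := by
      rw [chainB_apply, chainB_apply]
      exact hmono (Fin.succ_le_succ_iff.2 i.castSucc_lt_succ.le)
    have h₀ : F 0 ≤ chainB F i.castSucc := by
      rw [chainB_apply]
      exact hmono (Fin.zero_le _)
    have hne : i.castSucc ≠ i.succ := i.castSucc_lt_succ.ne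
    let m' := Function.update (Function.update m i.castSucc ⟨m i.succ, h₀ hm⟩) i.succ
      ⟨m i.castSucc, hB i (m i.castSucc).2⟩
    have hm' : (m' i.castSucc : V) = m i.succ := by simp [m', hne]
    have := multiExtMk_swap hB i m m' hm' (by simp [m']) fun j h₁ h₂ => by simp [m', h₁, h₂]
    rw [← neg_mem_iff, ← this]
    exact ih m' (hm'.symm ▸ hm)

theorem multiExtMk_sub_mem_range (hle : ∀ i : Fin (l + 1), F i.castSucc ≤ F i.succ)
    (hAB : ∀ (i : Fin (l + 1)) (x : V), x ∈ chainA F i →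
      LinearMap.id (R := R) x ∈ chainB F i)
    (m m' : ∀ i, chainB F i) (hm : ∀ i, ((m' i - m i : chainB F i) : V) ∈ F 0) :
    multiExtMk (chainB F) m' - multiExtMk (chainB F) m ∈
      LinearMap.range (multiExtMap (chainA F) (chainB F) LinearMap.id hAB) := by
  classical
  have h : m' = m + (m' - m) := (add_sub_cancel m m').symm
  rw [h, MultilinearMap.map_add_univ, ← Finset.sum_erase_add _ _ (Finset.mem_univ Finset.univ),
    Finset.piecewise_univ, add_sub_cancel_right]
  refine Submodule.sum_mem _ fun s hs => ?_
  obtain ⟨i, hi⟩ : ∃ i, i ∉ s := by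
    simpa [Finset.eq_univ_iff_forall] using Finset.ne_of_mem_erase hs
  refine multiExtMk_mem_range hle hAB i _ ?_
  simpa [hi] using hm i

/-- A retraction `ρ` of `B` onto `A` induces the section `x ↦ x - ρ x` of `B → B / A`. -/
theorem exists_section {A B : Submodule R V} (ρ : B →ₗ[R] A)
    (hρ : ∀ (x : B) (hx : (x : V) ∈ A), ρ x = ⟨x, hx⟩) :
    ∃ τ : B.map A.mkQ →ₗ[R] V, ∀ x (hx : x ∈ B),
      τ ⟨A.mkQ x, Submodule.mem_map_of_mem hx⟩ = x - ρ ⟨x, hx⟩ := by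
  let g : B →ₗ[R] B.map A.mkQ := A.mkQ.restrict fun x hx => Submodule.mem_map_of_mem hx
  have hg : Function.Surjective g := by
    rintro ⟨_, x, hx, rfl⟩
    exact ⟨⟨x, hx⟩, rfl⟩
  have hker : LinearMap.ker g ≤ LinearMap.ker (B.subtype - A.subtype ∘ₗ ρ) := by
    intro x hx
    have hx : (x : V) ∈ A := (Submodule.Quotient.mk_eq_zero A).1 (congrArg Subtype.val hx)
    simp [hρ x hx]
  refine ⟨(LinearMap.ker g).liftQ _ hker ∘ₗ (g.quotKerEquivOfSurjective hg).symm,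
    fun x hx => ?_⟩
  have : (⟨A.mkQ x, Submodule.mem_map_of_mem hx⟩ : B.map A.mkQ) = g ⟨x, hx⟩ := rfl
  rw [this, LinearMap.comp_apply, LinearEquiv.coe_coe,
    LinearMap.quotKerEquivOfSurjective_symm_apply]
  simp

theorem exists_multiExt_section (hle : ∀ i : Fin (l + 1), F i.castSucc ≤ F i.succ)
    (hsplit : ∀ i : Fin (l + 1), ∃ c : Submodule R V,
      c ≤ F i.succ ∧ F i.castSucc ⊓ c = ⊥ ∧ F i.castSucc ⊔ c = F i.succ)
    (hBC : ∀ (i : Fin (l + 1)) (x : V), x ∈ chainB F i → (F 0).mkQ x ∈ chainC F i) :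
    ∃ γ : multiExt (chainC F) →ₗ[R] multiExt (chainB F), ∀ m : ∀ i, chainB F i,
      ∃ m' : ∀ i, chainB F i, (∀ i, ((m' i - m i : chainB F i) : V) ∈ F 0) ∧
        γ (multiExtMk _ fun i => ⟨(F 0).mkQ (m i), hBC i _ (m i).2⟩) = multiExtMk _ m' := by
  have hmono : Monotone F := Fin.monotone_iff_le_succ.2 hle
  have hB (i) : chainB F i ≤ F (Fin.last (l + 1)) := by
    rw [chainB_apply]
    exact hmono (Fin.le_last _)
  have h₀ (i) : F 0 ≤ chainB F i := by
    rw [chainB_apply]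
    exact hmono (Fin.zero_le _)
  obtain ⟨ρ, hρ⟩ := exists_retraction hle hsplit 0
  obtain ⟨τ, hτ⟩ := exists_section ρ hρ
  have hC (i) : chainC F i ≤ (F (Fin.last (l + 1))).map (F 0).mkQ := Submodule.map_mono (hB i)
  let t (i) : chainC F i →ₗ[R] chainB F i :=
    (τ ∘ₗ Submodule.inclusion (hC i)).codRestrict (chainB F i) (by
      rintro ⟨_, x, hx, rfl⟩
      exact (hτ x (hB i hx)).symm ▸ sub_mem hx (h₀ i (ρ _).2))
  refine ⟨multiExtLift ((multiExtMk (chainB F)).compLinearMap t) fun m i h =>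
    multiExtMk_eq_zero _ i (congrArg τ (Subtype.ext h)),
    fun m => ⟨fun i => t i ⟨(F 0).mkQ (m i), hBC i _ (m i).2⟩, fun i => ?_, ?_⟩⟩
  · have : (t i ⟨(F 0).mkQ (m i), hBC i _ (m i).2⟩ : V) = m i - ρ ⟨m i, hB i (m i).2⟩ :=
      hτ _ _
    rw [AddSubgroupClass.coe_sub, this, sub_sub_cancel_left]
    exact neg_mem (ρ _).2
  · exact multiExtLift_mk _ _ _

end Exact

/-- Statement 16: for a chain `F 0 ⊆ F 1 ⊆ ⋯ ⊆ F (l+1)` (i.e. `W₁ ⊆ W₂ ⊆ U₁ ⊆ ⋯ ⊆ U_l`) of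
finitely generated projective submodules of `V`, each one a direct summand of the next, the
sequence `Λ^{l+1}(W₁,U₁,…,U_l) → Λ^{l+1}(W₂,U₁,…,U_l) → Λ^{l+1}(W₂/W₁,U₁/W₁,…,U_l/W₁)`
(first map induced by the inclusion `W₁ ↪ W₂`, second by the quotient map mod `W₁`) is short
exact. -/
theorem stmt_16 (R V : Type) [CommRing R] [AddCommGroup V] [Module R V]
    (l : ℕ) (F : Fin (l + 2) → Submodule R V)
    (hfg : ∀ i, Module.Finite R ↥(F i)) (hproj : ∀ i, Module.Projective R ↥(F i))
    (hle : ∀ i : Fin (l + 1), F i.castSucc ≤ F i.succ)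
    (hsplit : ∀ i : Fin (l + 1), ∃ c : Submodule R V,
      c ≤ F i.succ ∧ F i.castSucc ⊓ c = ⊥ ∧ F i.castSucc ⊔ c = F i.succ) :
    ∀ (hAB : ∀ (i : Fin (l + 1)) (x : V), x ∈ chainA F i →
        LinearMap.id (R := R) x ∈ chainB F i)
      (hBC : ∀ (i : Fin (l + 1)) (x : V), x ∈ chainB F i → (F 0).mkQ x ∈ chainC F i),
      Function.Injective (multiExtMap (chainA F) (chainB F) LinearMap.id hAB) ∧
      Function.Surjective (multiExtMap (chainB F) (chainC F) (F 0).mkQ hBC) ∧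
      LinearMap.range (multiExtMap (chainA F) (chainB F) LinearMap.id hAB) =
        LinearMap.ker (multiExtMap (chainB F) (chainC F) (F 0).mkQ hBC) := by
  intro hAB hBC
  obtain ⟨γ, hγ⟩ := exists_multiExt_section hle hsplit hBC
  refine ⟨multiExtMap_chainA_chainB_injective hfg hproj hle hsplit hAB, ?_, le_antisymm ?_ ?_⟩
  · suffices h : multiExtMap (chainB F) (chainC F) (F 0).mkQ hBC ∘ₗ γ = LinearMap.id from
      Function.RightInverse.surjective (LinearMap.congr_fun h)
    refine multiExt_hom_ext fun c => ?_
    have (i : Fin (l + 1)) : ∃ x : chainB F i, c i = ⟨(F 0).mkQ x, hBC i _ x.2⟩ := by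
      obtain ⟨x, hx, h⟩ := (c i).2
      exact ⟨⟨x, hx⟩, Subtype.ext h.symm⟩
    choose m hm using this
    obtain rfl : c = fun i => ⟨(F 0).mkQ (m i), hBC i _ (m i).2⟩ := funext hm
    obtain ⟨m', hm', h⟩ := hγ m
    rw [LinearMap.comp_apply, h, multiExtMap_mk, LinearMap.id_apply]
    exact congrArg _ (funext fun i => Subtype.ext ((Submodule.Quotient.eq _).2 (hm' i)))
  · rw [LinearMap.range_le_ker_iff]
    refine multiExt_hom_ext fun m => ?_
    rw [LinearMap.comp_apply, multiExtMap_mk, multiExtMap_mk, LinearMap.zero_apply]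
    refine MultilinearMap.map_coord_zero _ 0 (Subtype.ext ?_)
    exact (Submodule.Quotient.mk_eq_zero _).2 (m 0).2
  · intro z hz
    have key : (LinearMap.range (multiExtMap (chainA F) (chainB F) LinearMap.id hAB)).mkQ ∘ₗ
        (γ ∘ₗ multiExtMap (chainB F) (chainC F) (F 0).mkQ hBC - LinearMap.id) = 0 := by
      refine multiExt_hom_ext fun m => ?_
      obtain ⟨m', hm', h⟩ := hγ m
      rw [LinearMap.comp_apply, LinearMap.sub_apply, LinearMap.comp_apply, multiExtMap_mk, h,
        LinearMap.id_apply, LinearMap.zero_apply]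
      exact (Submodule.Quotient.mk_eq_zero _).2 (multiExtMk_sub_mem_range hle hAB m m' hm')
    have := (Submodule.Quotient.mk_eq_zero _).1 (LinearMap.congr_fun key z)
    rw [LinearMap.sub_apply, LinearMap.comp_apply, LinearMap.mem_ker.1 hz, map_zero, zero_sub,
      neg_mem_iff] at this
    exact this
end
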